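/- For the KKM potential V_iv, all five integrals are in involution with the Hamiltonian ({H,A₁} = {H,A₂} = {H,B₁} = {H,B₂} = {H,F} = 0), the brackets {A₁,A₂} = {A₁,B₂} = {A₂,B₁} = 0 vanish, and the square of C₁ = {A₁,B₁} satisfies C₁² = 2F₁ with F₁ = −8αB₁² + 2(A₁+A₂−H)(A₁(A₁+A₂−H) − βB₁) − (δ/2)(16αA₁ + β²); consequently {A₁,{A₁,B₁}} = −16αB₁ − 2β(A₁+A₂−H). -/

import Mathlib

noncomputable section

open MvPolynomial

/-- The field of rational functions over ℝ in the six variables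
`x, y, z, p_x, p_y, p_z`: the fraction field of the polynomial ring. -/
abbrev K6 : Type := FractionRing (MvPolynomial (Fin 6) ℝ)

/-- The canonical embedding of the polynomial ring into its fraction field. -/
def toK6 : MvPolynomial (Fin 6) ℝ →+* K6 :=
  algebraMap (MvPolynomial (Fin 6) ℝ) K6

/-- Constants, embedded in `K6`. -/
def cR (a : ℝ) : K6 := toK6 (MvPolynomial.C a)

def vx : K6 := toK6 (MvPolynomial.X 0)
def vy : K6 := toK6 (MvPolynomial.X 1)
def vz : K6 := toK6 (MvPolynomial.X 2)
def vpx : K6 := toK6 (MvPolynomial.X 3)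
def vpy : K6 := toK6 (MvPolynomial.X 4)
def vpz : K6 := toK6 (MvPolynomial.X 5)

/-- `D` is the (unique) extension to the fraction field of the formal partial
derivative `pderiv j` on the polynomial ring: an additive map satisfying the
Leibniz rule which agrees with `pderiv j` on polynomials. -/
def IsPDeriv (j : Fin 6) (D : K6 → K6) : Prop :=
  (∀ f g : K6, D (f + g) = D f + D g) ∧
  (∀ f g : K6, D (f * g) = D f * g + f * D g) ∧
  (∀ p, D (toK6 p) = toK6 (pderiv j p))

/-- The canonical Poisson bracket on `K6`, where `Pd 0, …, Pd 5` are the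
partial derivatives with respect to `x, y, z, p_x, p_y, p_z` respectively:
`{f,g} = f_x g_{p_x} + f_y g_{p_y} + f_z g_{p_z}
  - f_{p_x} g_x - f_{p_y} g_y - f_{p_z} g_z`. -/
def poisson (Pd : Fin 6 → K6 → K6) (f g : K6) : K6 :=
  Pd 0 f * Pd 3 g + Pd 1 f * Pd 4 g + Pd 2 f * Pd 5 g
    - Pd 3 f * Pd 0 g - Pd 4 f * Pd 1 g - Pd 5 f * Pd 2 g

/-- Angular momentum `J_x = y p_z - z p_y`. -/
def Jx : K6 := vy * vpz - vz * vpy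
/-- Angular momentum `J_y = z p_x - x p_z`. -/
def Jy : K6 := vz * vpx - vx * vpz
/-- Angular momentum `J_z = x p_y - y p_x`. -/
def Jz : K6 := vx * vpy - vy * vpx
/-- Total angular momentum squared `J² = J_x² + J_y² + J_z²`. -/
def Jsq : K6 := Jx ^ 2 + Jy ^ 2 + Jz ^ 2

/-- KKM V_iv Hamiltonian (generalized anisotropic oscillator). -/
def HV (α β γ δ : ℝ) : K6 :=
  vpx ^ 2 + vpy ^ 2 + vpz ^ 2 + cR α * (4 * vx ^ 2 + vy ^ 2 + vz ^ 2) + cR β * vx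
    + cR γ / vy ^ 2 + cR δ / vz ^ 2

def A1V (α β : ℝ) : K6 := vpx ^ 2 + 4 * cR α * vx ^ 2 + cR β * vx

def A2V (α γ : ℝ) : K6 := vpy ^ 2 + cR α * vy ^ 2 + cR γ / vy ^ 2

def B1V (α β δ : ℝ) : K6 :=
  Jy * vpz + cR α * vx * vz ^ 2 + cR β * vz ^ 2 / 4 - cR δ * vx / vz ^ 2

def B2V (γ δ : ℝ) : K6 := Jx ^ 2 + cR γ * vz ^ 2 / vy ^ 2 + cR δ * vy ^ 2 / vz ^ 2

def FV (α β γ : ℝ) : K6 :=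
  vpy * Jz - cR α * vx * vy ^ 2 - cR β * vy ^ 2 / 4 + cR γ * vx / vy ^ 2

/-- A derivation of a field kills numerals. -/
lemma Derivation.map_ofNat_eq_zero {K : Type*} [Field K] (D : Derivation ℤ K K) (n : ℕ)
    [n.AtLeastTwo] : D (ofNat(n) : K) = 0 :=
  D.map_natCast n

/-- An additive map on a field satisfying the Leibniz rule, as a derivation over `ℤ`. -/
def Derivation.ofLeibniz {K : Type*} [Field K] (D : K → K) (hadd : ∀ f g, D (f + g) = D f + D g)
    (hmul : ∀ f g, D (f * g) = D f * g + f * D g) : Derivation ℤ K K :=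
  Derivation.mk' (AddMonoidHom.mk' D hadd).toIntLinearMap fun f g => by
    simp [hmul, mul_comm, add_comm]

/-- The canonical Poisson bracket built from six maps `D 0, …, D 5` on a field. -/
def canonicalBracket {K : Type*} [Field K] (D : Fin 6 → K → K) (f g : K) : K :=
  D 0 f * D 3 g + D 1 f * D 4 g + D 2 f * D 5 g
    - D 3 f * D 0 g - D 4 f * D 1 g - D 5 f * D 2 g

/-- The bracket relations of the generalized anisotropic oscillator, over any field of
characteristic zero with derivations dual to canonical coordinates `v` and killing the
parameters `a, b, g, d`. -/
lemma canonicalBracket_anisotropicOscillator {K : Type*} [Field K] [CharZero K]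
    (D : Fin 6 → Derivation ℤ K K) (v : Fin 6 → K) (a b g d : K)
    (hv : ∀ i j, D i (v j) = if j = i then 1 else 0)
    (ha : ∀ i, D i a = 0) (hb : ∀ i, D i b = 0) (hg : ∀ i, D i g = 0) (hd : ∀ i, D i d = 0)
    (hy : v 1 ≠ 0) (hz : v 2 ≠ 0) (H A1 A2 B1 B2 F : K)
    (hH : H = v 3 ^ 2 + v 4 ^ 2 + v 5 ^ 2 + a * (4 * v 0 ^ 2 + v 1 ^ 2 + v 2 ^ 2) + b * v 0
      + g / v 1 ^ 2 + d / v 2 ^ 2)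
    (hA1 : A1 = v 3 ^ 2 + 4 * a * v 0 ^ 2 + b * v 0)
    (hA2 : A2 = v 4 ^ 2 + a * v 1 ^ 2 + g / v 1 ^ 2)
    (hB1 : B1 = (v 2 * v 3 - v 0 * v 5) * v 5 + a * v 0 * v 2 ^ 2 + b * v 2 ^ 2 / 4
      - d * v 0 / v 2 ^ 2)
    (hB2 : B2 = (v 1 * v 5 - v 2 * v 4) ^ 2 + g * v 2 ^ 2 / v 1 ^ 2 + d * v 1 ^ 2 / v 2 ^ 2)
    (hF : F = v 4 * (v 0 * v 4 - v 1 * v 3) - a * v 0 * v 1 ^ 2 - b * v 1 ^ 2 / 4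
      + g * v 0 / v 1 ^ 2) :
    letI P := canonicalBracket fun i => D i
    P H A1 = 0 ∧ P H A2 = 0 ∧ P H B1 = 0 ∧ P H B2 = 0 ∧ P H F = 0 ∧
    P A1 A2 = 0 ∧ P A1 B2 = 0 ∧ P A2 B1 = 0 ∧
    P A1 B1 ^ 2 =
      2 * (-8 * a * B1 ^ 2 + 2 * (A1 + A2 - H) * (A1 * (A1 + A2 - H) - b * B1)
        - d / 2 * (16 * a * A1 + b ^ 2)) ∧
    P A1 (P A1 B1) = -16 * a * B1 - 2 * b * (A1 + A2 - H) := by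
  subst hH hA1 hA2 hB1 hB2 hF
  have hC : canonicalBracket (fun i => D i) (v 3 ^ 2 + 4 * a * v 0 ^ 2 + b * v 0)
      ((v 2 * v 3 - v 0 * v 5) * v 5 + a * v 0 * v 2 ^ 2 + b * v 2 ^ 2 / 4 - d * v 0 / v 2 ^ 2) =
      (8 * a * v 0 + b) * v 2 * v 5 + 2 * v 3 * (v 5 ^ 2 - a * v 2 ^ 2 + d / v 2 ^ 2) := by
    simp [canonicalBracket, Derivation.leibniz_pow, Derivation.leibniz_div,
      Derivation.map_ofNat_eq_zero, hv, ha, hb, hd]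
    field_simp
    ring
  refine ⟨?_, ?_, ?_, ?_, ?_, ?_, ?_, ?_, ?_, ?_⟩
  case refine_9 =>
    rw [hC]
    field_simp
    ring
  case refine_10 =>
    rw [hC]
    simp [canonicalBracket, Derivation.leibniz_pow, Derivation.leibniz_div,
      Derivation.map_ofNat_eq_zero, hv, ha, hb, hd]
    field_simp
    ring
  all_goals
    simp [canonicalBracket, Derivation.leibniz_pow, Derivation.leibniz_div,
      Derivation.map_ofNat_eq_zero, hv, ha, hb, hg, hd] <;>
    field_simp <;>
    ring

lemma IsPDeriv.map_X {j : Fin 6} {D : K6 → K6} (h : IsPDeriv j D) (i : Fin 6) :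
    D (toK6 (X i)) = if i = j then 1 else 0 := by
  rw [h.2.2, pderiv_X, Pi.single_apply]
  split_ifs <;> simp

lemma IsPDeriv.map_cR {j : Fin 6} {D : K6 → K6} (h : IsPDeriv j D) (a : ℝ) : D (cR a) = 0 := by
  rw [cR, h.2.2, pderiv_C, map_zero]

lemma toK6_X_ne_zero (i : Fin 6) : toK6 (X i) ≠ 0 :=
  (map_ne_zero_iff toK6 (IsFractionRing.injective _ K6)).2 (X_ne_zero i)

theorem kkm_Viv_algebra (α β γ δ : ℝ) (Pd : Fin 6 → K6 → K6)
    (hPd : ∀ j, IsPDeriv j (Pd j))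
    (H A1 A2 B1 B2 F : K6)
    (hH : H = HV α β γ δ) (hA1 : A1 = A1V α β) (hA2 : A2 = A2V α γ)
    (hB1 : B1 = B1V α β δ) (hB2 : B2 = B2V γ δ) (hF : F = FV α β γ) :
    poisson Pd H A1 = 0 ∧ poisson Pd H A2 = 0 ∧ poisson Pd H B1 = 0 ∧
      poisson Pd H B2 = 0 ∧ poisson Pd H F = 0 ∧
    poisson Pd A1 A2 = 0 ∧ poisson Pd A1 B2 = 0 ∧ poisson Pd A2 B1 = 0 ∧
    (poisson Pd A1 B1) ^ 2 =
      2 * (-8 * cR α * B1 ^ 2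
        + 2 * (A1 + A2 - H) * (A1 * (A1 + A2 - H) - cR β * B1)
        - cR δ / 2 * (16 * cR α * A1 + cR β ^ 2)) ∧
    poisson Pd A1 (poisson Pd A1 B1) = -16 * cR α * B1 - 2 * cR β * (A1 + A2 - H) := by
  have : CharZero K6 :=
    charZero_of_injective_algebraMap (IsFractionRing.injective (MvPolynomial (Fin 6) ℝ) K6)
  exact canonicalBracket_anisotropicOscillator (fun j => .ofLeibniz (Pd j) (hPd j).1 (hPd j).2.1)
    (fun i => toK6 (X i)) (cR α) (cR β) (cR γ) (cR δ) (fun i j => (hPd i).map_X j)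
    (fun i => (hPd i).map_cR α) (fun i => (hPd i).map_cR β) (fun i => (hPd i).map_cR γ)
    (fun i => (hPd i).map_cR δ) (toK6_X_ne_zero 1) (toK6_X_ne_zero 2)
    H A1 A2 B1 B2 F hH hA1 hA2 hB1 hB2 hF
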